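/- If u ~ N(0, I_d) and A is a positive semi-definite d×d matrix, then E[(uᵀAu)⁴] = Tr(A)⁴ + 32·Tr(A)·Tr(A³) + 12·Tr(A²)² + 12·Tr(A)²·Tr(A²) + 48·Tr(A⁴), and hence E[(uᵀAu)⁴] ≤ 105·Tr(A)⁴. -/

import Mathlib

open MeasureTheory ProbabilityTheory Matrix

/-- The standard Gaussian measure `N(0, I_d)` on `ℝ^d`. -/
noncomputable def stdGaussian (d : ℕ) : Measure (Fin d → ℝ) :=
  Measure.pi fun _ => gaussianReal 0 1

section Auxiliary

open Finset

/-- Fourth-order moment data of a sum of independent scaled chi-squared variables, in terms of the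
power sums `p₁, …, p₄` of the weights. -/
structure HasChiSquaredSumMoments {Ω : Type*} [MeasurableSpace Ω] (Y : Ω → ℝ) (μ : Measure Ω)
    (p₁ p₂ p₃ p₄ : ℝ) : Prop where
  integrable_pow : ∀ k : ℕ, Integrable (fun ω => Y ω ^ k) μ
  moment_one : ∫ ω, Y ω ∂μ = p₁
  moment_two : ∫ ω, Y ω ^ 2 ∂μ = p₁ ^ 2 + 2 * p₂
  moment_three : ∫ ω, Y ω ^ 3 ∂μ = p₁ ^ 3 + 6 * p₁ * p₂ + 8 * p₃
  moment_four : ∫ ω, Y ω ^ 4 ∂μ =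
    p₁ ^ 4 + 32 * p₁ * p₃ + 12 * p₂ ^ 2 + 12 * p₁ ^ 2 * p₂ + 48 * p₄

lemma integral_pow_add_two_gaussianReal (n : ℕ) :
    ∫ x, x ^ (n + 2) ∂(gaussianReal 0 1) = (n + 1) * ∫ x, x ^ n ∂(gaussianReal 0 1) := by
  have key : ∀ m : ℕ, ∫ x, x ^ m ∂(gaussianReal 0 1) =
      iteratedDeriv m (fun t : ℝ => Real.exp (t ^ 2 / 2)) 0 := fun m => by
    have h := iteratedDeriv_mgf_zero (X := id) (μ := gaussianReal 0 1) (by simp) m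
    rw [mgf_id_gaussianReal] at h
    simpa using h.symm
  rw [key, key, iteratedDeriv_succ']
  have hd : deriv (fun t : ℝ => Real.exp (t ^ 2 / 2)) =
      fun t => t * Real.exp (t ^ 2 / 2) := by
    ext t
    rw [_root_.deriv_exp (by fun_prop)]
    simp [mul_comm]
  have hid : ∀ k : ℕ, iteratedDeriv k (fun t : ℝ => t) 0 = if k = 1 then 1 else 0 := by
    intro k
    have h := iteratedDeriv_fun_pow_zero (𝕜 := ℝ) (n := k) (m := 1)
    simp only [pow_one] at h
    simpa only [Nat.factorial_one, Nat.cast_ite, Nat.cast_one, Nat.cast_zero] using h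
  rw [hd, iteratedDeriv_fun_mul (by fun_prop) (by fun_prop)]
  rw [sum_eq_single 1]
  · simp [hid]
  · intro b _ hb
    simp [hid, hb]
  · simp

lemma integral_sq_gaussianReal : ∫ x, x ^ 2 ∂(gaussianReal 0 1) = 1 := by
  simpa using integral_pow_add_two_gaussianReal 0

lemma integral_pow_four_gaussianReal : ∫ x, x ^ 4 ∂(gaussianReal 0 1) = 3 := by
  rw [integral_pow_add_two_gaussianReal 2, integral_sq_gaussianReal]
  norm_num

lemma integral_pow_six_gaussianReal : ∫ x, x ^ 6 ∂(gaussianReal 0 1) = 15 := by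
  rw [integral_pow_add_two_gaussianReal 4, integral_pow_four_gaussianReal]
  norm_num

lemma integral_pow_eight_gaussianReal : ∫ x, x ^ 8 ∂(gaussianReal 0 1) = 105 := by
  rw [integral_pow_add_two_gaussianReal 6, integral_pow_six_gaussianReal]
  norm_num

lemma integrable_pow_gaussianReal (n : ℕ) :
    Integrable (fun x : ℝ => x ^ n) (gaussianReal 0 1) := by
  have h := (memLp_id_gaussianReal (μ := 0) (v := 1) n).integrable_norm_pow'
  exact (integrable_norm_iff (by fun_prop)).1 (by simpa using h)

lemma hasChiSquaredSumMoments_const_mul_sq (c : ℝ) :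
    HasChiSquaredSumMoments (fun x => c * x ^ 2) (gaussianReal 0 1) c (c ^ 2) (c ^ 3) (c ^ 4) where
  integrable_pow k := by
    simp_rw [mul_pow, ← pow_mul]
    exact (integrable_pow_gaussianReal _).const_mul _
  moment_one := by rw [integral_const_mul, integral_sq_gaussianReal, mul_one]
  moment_two := by
    simp_rw [mul_pow, ← pow_mul]
    rw [integral_const_mul, integral_pow_four_gaussianReal]
    ring
  moment_three := by
    simp_rw [mul_pow, ← pow_mul]
    rw [integral_const_mul, integral_pow_six_gaussianReal]
    ring
  moment_four := by
    simp_rw [mul_pow, ← pow_mul]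
    rw [integral_const_mul, integral_pow_eight_gaussianReal]
    ring

namespace HasChiSquaredSumMoments

variable {Ω : Type*} [MeasurableSpace Ω] {μ : Measure Ω} {X Y : Ω → ℝ}
  {p₁ p₂ p₃ p₄ q₁ q₂ q₃ q₄ : ℝ}

lemma comp_measurePreserving {Ω' : Type*} [MeasurableSpace Ω'] {ν : Measure Ω'} {f : Ω' → Ω}
    (hX : HasChiSquaredSumMoments X μ p₁ p₂ p₃ p₄) (hf : MeasurePreserving f ν μ)
    (hXm : Measurable X) : HasChiSquaredSumMoments (X ∘ f) ν p₁ p₂ p₃ p₄ := by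
  have key : ∀ k : ℕ, ∫ ω, (X ∘ f) ω ^ k ∂ν = ∫ ω, X ω ^ k ∂μ := fun k => by
    rw [← hf.map_eq, integral_map hf.aemeasurable (by fun_prop)]
    rfl
  refine ⟨fun k => ?_, ?_, (key 2).trans hX.moment_two, (key 3).trans hX.moment_three,
    (key 4).trans hX.moment_four⟩
  · exact hf.integrable_comp_of_integrable (hX.integrable_pow k)
  · simpa using (key 1).trans (by simpa using hX.moment_one)

lemma add [IsProbabilityMeasure μ] (hX : HasChiSquaredSumMoments X μ p₁ p₂ p₃ p₄)
    (hY : HasChiSquaredSumMoments Y μ q₁ q₂ q₃ q₄) (hXY : IndepFun X Y μ) :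
    HasChiSquaredSumMoments (X + Y) μ (p₁ + q₁) (p₂ + q₂) (p₃ + q₃) (p₄ + q₄) := by
  have hind : ∀ a b : ℕ, IndepFun (fun ω => X ω ^ a) (fun ω => Y ω ^ b) μ := fun a b =>
    hXY.comp (φ := fun x => x ^ a) (ψ := fun y => y ^ b) (by fun_prop) (by fun_prop)
  have hint : ∀ a b : ℕ, Integrable (fun ω => X ω ^ a * Y ω ^ b) μ := fun a b =>
    (hind a b).integrable_mul (hX.integrable_pow a) (hY.integrable_pow b)
  have hmul : ∀ a b : ℕ, ∫ ω, X ω ^ a * Y ω ^ b ∂μ = (∫ ω, X ω ^ a ∂μ) * ∫ ω, Y ω ^ b ∂μ :=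
    fun a b => (hind a b).integral_fun_mul_eq_mul_integral
      (hX.integrable_pow a).aestronglyMeasurable (hY.integrable_pow b).aestronglyMeasurable
  have hexp : ∀ k : ℕ, ∫ ω, (X + Y) ω ^ k ∂μ =
      ∑ m ∈ range (k + 1), (∫ ω, X ω ^ m ∂μ) * (∫ ω, Y ω ^ (k - m) ∂μ) * (k.choose m : ℝ) := by
    intro k
    simp_rw [Pi.add_apply, add_pow]
    rw [integral_finsetSum _ fun m _ => (hint m (k - m)).mul_const _]
    simp_rw [integral_mul_const, hmul]
  refine ⟨fun k => ?_, ?_, ?_, ?_, ?_⟩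
  · simp_rw [Pi.add_apply, add_pow]
    exact integrable_finsetSum _ fun m _ => (hint m (k - m)).mul_const _
  · have h := hexp 1
    simp only [pow_one] at h
    rw [h]
    simp [sum_range_succ, hX.moment_one, hY.moment_one]
    ring
  · rw [hexp]
    simp [sum_range_succ, hX.moment_one, hY.moment_one, hX.moment_two, hY.moment_two]
    ring
  · rw [hexp]
    simp [sum_range_succ, hX.moment_one, hY.moment_one, hX.moment_two, hY.moment_two,
      hX.moment_three, hY.moment_three, Nat.choose]
    ring
  · rw [hexp]
    simp [sum_range_succ, hX.moment_one, hY.moment_one, hX.moment_two, hY.moment_two,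
      hX.moment_three, hY.moment_three, hX.moment_four, hY.moment_four, Nat.choose]
    ring

lemma zero [IsProbabilityMeasure μ] : HasChiSquaredSumMoments (0 : Ω → ℝ) μ 0 0 0 0 := by
  constructor <;> simp

lemma finsetSum [IsProbabilityMeasure μ] {ι : Type*} {X : ι → Ω → ℝ} {c : ι → ℝ}
    (hX : ∀ i, HasChiSquaredSumMoments (X i) μ (c i) (c i ^ 2) (c i ^ 3) (c i ^ 4))
    (hXm : ∀ i, Measurable (X i)) (hind : iIndepFun X μ) (s : Finset ι) :
    HasChiSquaredSumMoments (∑ i ∈ s, X i) μ (∑ i ∈ s, c i) (∑ i ∈ s, c i ^ 2)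
      (∑ i ∈ s, c i ^ 3) (∑ i ∈ s, c i ^ 4) := by
  classical
  induction s using Finset.induction_on with
  | empty => simpa using zero
  | insert i s hi ih =>
    simp_rw [sum_insert hi]
    exact (hX i).add ih (hind.indepFun_finsetSum_of_notMem hXm hi).symm

end HasChiSquaredSumMoments

lemma integral_sum_mul_sq_pow_four {ι : Type*} [Fintype ι] (c : ι → ℝ) :
    ∫ x, (∑ i, c i * x i ^ 2) ^ 4 ∂(Measure.pi fun _ : ι => gaussianReal 0 1) =
      (∑ i, c i) ^ 4 + 32 * (∑ i, c i) * (∑ i, c i ^ 3) + 12 * (∑ i, c i ^ 2) ^ 2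
        + 12 * (∑ i, c i) ^ 2 * (∑ i, c i ^ 2) + 48 * ∑ i, c i ^ 4 := by
  have h := HasChiSquaredSumMoments.finsetSum
    (μ := Measure.pi fun _ : ι => gaussianReal 0 1)
    (X := fun i (x : ι → ℝ) => c i * x i ^ 2)
    (fun i => (hasChiSquaredSumMoments_const_mul_sq (c i)).comp_measurePreserving
      (measurePreserving_eval (fun _ : ι => gaussianReal 0 1) i) (by fun_prop))
    (fun i => by fun_prop)
    (iIndepFun_pi (X := fun i (y : ℝ) => c i * y ^ 2) fun i => by fun_prop) univ
  simpa using h.moment_four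

lemma integral_pi_gaussianReal_eq_orthonormalBasis {ι : Type*} [Fintype ι]
    (b : OrthonormalBasis ι ℝ (EuclideanSpace ℝ ι)) {f : (ι → ℝ) → ℝ} (hf : Continuous f) :
    ∫ u, f u ∂(Measure.pi fun _ : ι => gaussianReal 0 1) =
      ∫ x, f (∑ i, x i • b i).ofLp ∂(Measure.pi fun _ : ι => gaussianReal 0 1) := by
  have h := (map_pi_eq_stdGaussian (ι := ι)).trans (stdGaussian_eq_map_pi_orthonormalBasis b)
  have h' := congrArg (fun ν => ∫ v, f (WithLp.ofLp v) ∂ν) h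
  have hc : Continuous fun v : EuclideanSpace ℝ ι => f v.ofLp :=
    hf.comp (PiLp.continuous_ofLp 2 _)
  simp only at h'
  rwa [integral_map (by fun_prop) hc.aestronglyMeasurable,
    integral_map (Continuous.aemeasurable (by fun_prop)) hc.aestronglyMeasurable] at h'

lemma Matrix.IsHermitian.dotProduct_mulVec_sum_eigenvectorBasis {ι : Type*} [Fintype ι]
    [DecidableEq ι] {A : Matrix ι ι ℝ} (hA : A.IsHermitian) (x : ι → ℝ) :
    (∑ i, x i • hA.eigenvectorBasis i).ofLp ⬝ᵥ
      A.mulVec (∑ i, x i • hA.eigenvectorBasis i).ofLp = ∑ i, hA.eigenvalues i * x i ^ 2 := by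
  have hv : A.mulVec (∑ i, x i • hA.eigenvectorBasis i).ofLp =
      (∑ i, (hA.eigenvalues i * x i) • hA.eigenvectorBasis i).ofLp := by
    simp only [WithLp.ofLp_sum, WithLp.ofLp_smul, mulVec_sum, mulVec_smul,
      hA.mulVec_eigenvectorBasis, smul_smul, mul_comm]
  have h := hA.eigenvectorBasis.orthonormal.inner_sum (fun i => hA.eigenvalues i * x i) x univ
  rw [hv]
  rw [EuclideanSpace.inner_eq_star_dotProduct] at h
  simp only [star_trivial, conj_trivial] at h
  rw [h]
  exact sum_congr rfl fun i _ => by ring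

lemma Matrix.IsHermitian.trace_pow_eq_sum_eigenvalues_pow {ι : Type*} [Fintype ι]
    [DecidableEq ι] {A : Matrix ι ι ℝ} (hA : A.IsHermitian) (k : ℕ) :
    (A ^ k).trace = ∑ i, hA.eigenvalues i ^ k := by
  conv_lhs => rw [hA.spectral_theorem, ← map_pow, Unitary.conjStarAlgAut_apply,
    trace_mul_cycle, Unitary.coe_star_mul_self, one_mul, diagonal_pow, trace_diagonal]
  simp

lemma sum_pow_le_pow_sum_of_nonneg {ι : Type*} (s : Finset ι) {c : ι → ℝ} (hc : ∀ i, 0 ≤ c i)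
    (k : ℕ) : ∑ i ∈ s, c i ^ (k + 1) ≤ (∑ i ∈ s, c i) ^ (k + 1) := by
  induction k with
  | zero => simp
  | succ k ih =>
    calc ∑ i ∈ s, c i ^ (k + 1 + 1) ≤ ∑ i ∈ s, c i ^ (k + 1) * ∑ j ∈ s, c j := by
          refine sum_le_sum fun i hi => ?_
          rw [pow_succ]
          exact mul_le_mul_of_nonneg_left (single_le_sum (fun j _ => hc j) hi)
            (pow_nonneg (hc i) _)
      _ = (∑ i ∈ s, c i ^ (k + 1)) * ∑ j ∈ s, c j := by rw [sum_mul]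
      _ ≤ (∑ i ∈ s, c i) ^ (k + 1) * ∑ j ∈ s, c j :=
          mul_le_mul_of_nonneg_right ih (sum_nonneg fun j _ => hc j)
      _ = _ := (pow_succ _ _).symm

end Auxiliary

theorem gaussian_quadratic_form_fourth_moment
    (d : ℕ) (A : Matrix (Fin d) (Fin d) ℝ) (hA : A.PosSemidef) :
    (∫ u, (u ⬝ᵥ A.mulVec u) ^ 4 ∂(stdGaussian d))
        = A.trace ^ 4 + 32 * A.trace * (A * A * A).trace
          + 12 * (A * A).trace ^ 2 + 12 * A.trace ^ 2 * (A * A).trace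
          + 48 * (A * A * A * A).trace ∧
    (∫ u, (u ⬝ᵥ A.mulVec u) ^ 4 ∂(stdGaussian d)) ≤ 105 * A.trace ^ 4 := by
  have hH := hA.isHermitian
  have ht := hH.trace_pow_eq_sum_eigenvalues_pow
  have h₁ : A.trace = ∑ i, hH.eigenvalues i := by simpa using ht 1
  have h₂ : (A * A).trace = ∑ i, hH.eigenvalues i ^ 2 := by rw [← ht 2, pow_two]
  have h₃ : (A * A * A).trace = ∑ i, hH.eigenvalues i ^ 3 := by rw [← ht 3, pow_three']
  have h₄ : (A * A * A * A).trace = ∑ i, hH.eigenvalues i ^ 4 := by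
    rw [← ht 4, pow_succ, pow_three']
  have hmom : ∫ u, (u ⬝ᵥ A.mulVec u) ^ 4 ∂(stdGaussian d)
        = A.trace ^ 4 + 32 * A.trace * (A * A * A).trace
          + 12 * (A * A).trace ^ 2 + 12 * A.trace ^ 2 * (A * A).trace
          + 48 * (A * A * A * A).trace := by
    rw [h₁, h₂, h₃, h₄, _root_.stdGaussian, integral_pi_gaussianReal_eq_orthonormalBasis
      hH.eigenvectorBasis (f := fun u => (u ⬝ᵥ A.mulVec u) ^ 4) (by fun_prop)]
    simp_rw [hH.dotProduct_mulVec_sum_eigenvectorBasis]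
    exact integral_sum_mul_sq_pow_four hH.eigenvalues
  refine ⟨hmom, hmom.trans_le ?_⟩
  have hpos := hA.eigenvalues_nonneg
  have htr : 0 ≤ A.trace := h₁ ▸ Finset.sum_nonneg fun i _ => hpos i
  have h0 : 0 ≤ (A * A).trace := h₂ ▸ Finset.sum_nonneg fun i _ => pow_nonneg (hpos i) 2
  have b₂ : (A * A).trace ≤ A.trace ^ 2 := by
    rw [h₁, h₂]; exact sum_pow_le_pow_sum_of_nonneg _ hpos 1
  have b₃ : (A * A * A).trace ≤ A.trace ^ 3 := by
    rw [h₁, h₃]; exact sum_pow_le_pow_sum_of_nonneg _ hpos 2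
  have b₄ : (A * A * A * A).trace ≤ A.trace ^ 4 := by
    rw [h₁, h₄]; exact sum_pow_le_pow_sum_of_nonneg _ hpos 3
  calc _ ≤ A.trace ^ 4 + 32 * A.trace * A.trace ^ 3 + 12 * (A.trace ^ 2) ^ 2
        + 12 * A.trace ^ 2 * A.trace ^ 2 + 48 * A.trace ^ 4 := by gcongr
    _ = 105 * A.trace ^ 4 := by ring
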